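/- Let k ≥ 1 be an integer and for each i = 1,…,k let m_i ≥ 1 be an integer. For each i and each j = 1,…,m_i let b_{ij} be a real number with b_{ij} ≥ 2 and let a_{ij} be a real number with a_{ij} > 0. Then the set of real tuples (t, (x_{ij})_{i,j}) satisfying x_{i,j−1} − b_{ij}·x_{ij} + x_{i,j+1} + a_{ij}·t = 0 for all i = 1,…,k and j = 1,…,m_i (with the convention x_{i,0} = x_{i,m_i+1} = 0) is a one-dimensional linear subspace of ℝ^{1+Σ_i m_i}; equivalently, any two nonzero solutions are proportional. -/

import Mathlib

/-- The sequence with `x 0 = 0`, `x 1 = s` and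
`x n - b (n + 1) * x (n + 1) + x (n + 2) + g (n + 1) = 0`. -/
noncomputable def chainSeq (b g : ℕ → ℝ) (s : ℝ) : ℕ → ℝ
  | 0 => 0
  | 1 => s
  | n + 2 => b (n + 1) * chainSeq b g s (n + 1) - chainSeq b g s n - g (n + 1)

theorem chainSeq_nonneg_and_lt_succ {b : ℕ → ℝ} {m : ℕ}
    (hb : ∀ j, 1 ≤ j → j ≤ m → 2 ≤ b j) (n : ℕ) (hn : n ≤ m) :
    0 ≤ chainSeq b 0 1 n ∧ chainSeq b 0 1 n < chainSeq b 0 1 (n + 1) := by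
  induction n with
  | zero => simp [chainSeq]
  | succ n ih =>
    obtain ⟨h0, h1⟩ := ih (by omega)
    have h2 := hb (n + 1) (by omega) hn
    refine ⟨by linarith, ?_⟩
    simp only [chainSeq, Pi.zero_apply]
    nlinarith

theorem chainSeq_succ_pos {b : ℕ → ℝ} {m : ℕ} (hb : ∀ j, 1 ≤ j → j ≤ m → 2 ≤ b j) :
    0 < chainSeq b 0 1 (m + 1) := by
  obtain ⟨h0, h1⟩ := chainSeq_nonneg_and_lt_succ hb m le_rfl
  linarith

theorem exists_chain_solution {b : ℕ → ℝ} {m : ℕ} (hb : ∀ j, 1 ≤ j → j ≤ m → 2 ≤ b j)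
    (a : ℕ → ℝ) :
    ∃ x : ℕ → ℝ, x 0 = 0 ∧ x (m + 1) = 0 ∧
      ∀ j, 1 ≤ j → x (j - 1) - b j * x j + x (j + 1) + a j = 0 := by
  have hp := (chainSeq_succ_pos hb).ne'
  refine ⟨fun n => chainSeq b a 0 n -
    chainSeq b a 0 (m + 1) / chainSeq b 0 1 (m + 1) * chainSeq b 0 1 n, ?_, ?_, ?_⟩
  · simp [chainSeq]
  · field_simp
    ring
  · rintro (_ | j) hj
    · omega
    · simp only [Nat.add_sub_cancel, chainSeq, Pi.zero_apply]
      ring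

theorem chain_eq_zero_of_homogeneous {b y : ℕ → ℝ} {m : ℕ}
    (hb : ∀ j, 1 ≤ j → j ≤ m → 2 ≤ b j) (h0 : y 0 = 0) (hm : y (m + 1) = 0)
    (hy : ∀ j, 1 ≤ j → j ≤ m → y (j - 1) - b j * y j + y (j + 1) = 0)
    {j : ℕ} (hj : j ≤ m) : y j = 0 := by
  have key : ∀ n ≤ m, y n = y 1 * chainSeq b 0 1 n ∧
      y (n + 1) = y 1 * chainSeq b 0 1 (n + 1) := by
    intro n hn
    induction n with
    | zero => simp [chainSeq, h0]
    | succ n ih =>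
      obtain ⟨h1, h2⟩ := ih (by omega)
      refine ⟨h2, ?_⟩
      have h3 := hy (n + 1) (by omega) hn
      simp only [Nat.add_sub_cancel] at h3
      simp only [chainSeq, Pi.zero_apply]
      linear_combination h3 - h1 + b (n + 1) * h2
  have h1 : y 1 = 0 := by
    have h2 := (key m le_rfl).2
    rw [hm] at h2
    exact (mul_eq_zero.mp h2.symm).resolve_right (chainSeq_succ_pos hb).ne'
  rw [(key j hj).1, h1, zero_mul]

/-- For `k` disjoint chains, the solution set of the block system
`x_{i,j-1} - b_{ij} x_{ij} + x_{i,j+1} + a_{ij} t = 0` (with the convention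
`x_{i,0} = x_{i,m_i+1} = 0`) is a one-dimensional linear subspace of
`ℝ^{1+Σᵢ mᵢ}`: there is a nonzero solution, and any two nonzero solutions are
proportional. -/
theorem stmt_8 (k : ℕ) (hk : 1 ≤ k) (m : ℕ → ℕ)
    (hm : ∀ i, 1 ≤ i → i ≤ k → 1 ≤ m i)
    (b a : ℕ → ℕ → ℝ)
    (hb : ∀ i j, 1 ≤ i → i ≤ k → 1 ≤ j → j ≤ m i → 2 ≤ b i j)
    (ha : ∀ i j, 1 ≤ i → i ≤ k → 1 ≤ j → j ≤ m i → 0 < a i j) :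
    (∃ (t : ℝ) (x : ℕ → ℕ → ℝ),
      (∀ i, 1 ≤ i → i ≤ k → x i 0 = 0 ∧ x i (m i + 1) = 0) ∧
      (∀ i j, 1 ≤ i → i ≤ k → 1 ≤ j → j ≤ m i →
        x i (j - 1) - b i j * x i j + x i (j + 1) + a i j * t = 0) ∧
      ¬ (t = 0 ∧ ∀ i j, 1 ≤ i → i ≤ k → 1 ≤ j → j ≤ m i → x i j = 0)) ∧
    (∀ (t t' : ℝ) (x x' : ℕ → ℕ → ℝ),
      (∀ i, 1 ≤ i → i ≤ k → x i 0 = 0 ∧ x i (m i + 1) = 0) →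
      (∀ i j, 1 ≤ i → i ≤ k → 1 ≤ j → j ≤ m i →
        x i (j - 1) - b i j * x i j + x i (j + 1) + a i j * t = 0) →
      ¬ (t = 0 ∧ ∀ i j, 1 ≤ i → i ≤ k → 1 ≤ j → j ≤ m i → x i j = 0) →
      (∀ i, 1 ≤ i → i ≤ k → x' i 0 = 0 ∧ x' i (m i + 1) = 0) →
      (∀ i j, 1 ≤ i → i ≤ k → 1 ≤ j → j ≤ m i →
        x' i (j - 1) - b i j * x' i j + x' i (j + 1) + a i j * t' = 0) →
      ¬ (t' = 0 ∧ ∀ i j, 1 ≤ i → i ≤ k → 1 ≤ j → j ≤ m i → x' i j = 0) →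
      ∃ c : ℝ, t' = c * t ∧
        ∀ i j, 1 ≤ i → i ≤ k → 1 ≤ j → j ≤ m i → x' i j = c * x i j) := by
  have hom : ∀ y : ℕ → ℕ → ℝ,
      (∀ i, 1 ≤ i → i ≤ k → y i 0 = 0 ∧ y i (m i + 1) = 0) →
      (∀ i j, 1 ≤ i → i ≤ k → 1 ≤ j → j ≤ m i →
        y i (j - 1) - b i j * y i j + y i (j + 1) = 0) →
      ∀ i j, 1 ≤ i → i ≤ k → 1 ≤ j → j ≤ m i → y i j = 0 :=
    fun y hy0 hy i j hi hik _ hjm =>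
      chain_eq_zero_of_homogeneous (fun j => hb i j hi hik) (hy0 i hi hik).1 (hy0 i hi hik).2
        (fun j => hy i j hi hik) hjm
  constructor
  · have hex : ∀ i, ∃ x : ℕ → ℝ, 1 ≤ i → i ≤ k → x 0 = 0 ∧ x (m i + 1) = 0 ∧
        ∀ j, 1 ≤ j → x (j - 1) - b i j * x j + x (j + 1) + a i j = 0 := by
      intro i
      by_cases hi : 1 ≤ i ∧ i ≤ k
      · obtain ⟨x, hx⟩ := exists_chain_solution (fun j => hb i j hi.1 hi.2) (a i)
        exact ⟨x, fun _ _ => hx⟩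
      · exact ⟨0, fun h1 h2 => (hi ⟨h1, h2⟩).elim⟩
    choose x hx using hex
    refine ⟨1, x, fun i hi hik => ⟨(hx i hi hik).1, (hx i hi hik).2.1⟩, ?_, by simp⟩
    intro i j hi hik hj _
    rw [mul_one]
    exact (hx i hi hik).2.2 j hj
  · intro t t' x x' hx0 hx hne hx0' hx' _
    have ht : t ≠ 0 := by
      rintro rfl
      exact hne ⟨rfl, hom x hx0 (by simpa using hx)⟩
    refine ⟨t' / t, by field_simp, fun i j hi hik hj hjm => ?_⟩
    refine sub_eq_zero.mp (hom (fun i j => x' i j - t' / t * x i j) ?_ ?_ i j hi hik hj hjm)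
    · intro i hi hik
      simp [hx0 i hi hik, hx0' i hi hik]
    · intro i j hi hik hj hjm
      have hc : t' / t * t = t' := by field_simp
      linear_combination hx' i j hi hik hj hjm - t' / t * hx i j hi hik hj hjm + a i j * hc
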